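/- Let $z = (z_i^{(j)})$ be real numbers such that $z_1^{(1)},\dots,z_n^{(1)}$ are pairwise distinct. Then for any two $k$-element subsets $I, J \subseteq \{1,\dots,n\}$ and any $m \in \{1,\dots,n\}$, $\big(\bar H_m(z_1^{(1)},\dots,z_n^{(1)})\,v_I,\;v_J\big) = \dfrac{\partial}{\partial z_m^{(1)}}\,\partial_I\,\partial_J\,Q(z)$, where the right-hand side is the indicated iterated partial derivative of the function $Q$ evaluated at $z$. -/

import Mathlib

noncomputable section

/-- The `sl₂`-module `W^{⊗n}`, `W = ℂ²`, identified with the free complex vector space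
on the set of subsets of `{1,…,n}`. -/
abbrev WT (n : ℕ) := Finset (Fin n) →₀ ℂ

/-- Build a linear operator on `WT n` from its values on the basis vectors `V_I`. -/
def mkOp {n : ℕ} (φ : Finset (Fin n) → WT n) : WT n →ₗ[ℂ] WT n :=
  Finsupp.lsum ℂ fun I => LinearMap.toSpanSingleton ℂ (WT n) (φ I)

/-- Diagonal action of `e`: `e V_I = ∑_{i ∈ I} V_{I∖{i}}`. -/
def opE (n : ℕ) : WT n →ₗ[ℂ] WT n :=
  mkOp fun I => ∑ i ∈ I, Finsupp.single (I.erase i) 1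

/-- Diagonal action of `f`: `f V_I = ∑_{i ∉ I} V_{I∪{i}}`. -/
def opF (n : ℕ) : WT n →ₗ[ℂ] WT n :=
  mkOp fun I => ∑ i ∈ Iᶜ, Finsupp.single (insert i I) 1

/-- Diagonal action of `h`: `h V_I = (n - 2|I|) V_I`. -/
def opH (n : ℕ) : WT n →ₗ[ℂ] WT n :=
  mkOp fun I => ((n : ℂ) - 2 * I.card) • Finsupp.single I 1

/-- The Shapovalov form: the symmetric bilinear form with `(V_I, V_J) = δ_{IJ}`. -/
def shap {n : ℕ} (x y : WT n) : ℂ := x.sum fun I c => c * y I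

/-- The weight space `W^{⊗n}[n-2k]`, spanned by the `V_I` with `|I| = k`. -/
def weight (n k : ℕ) : Submodule ℂ (WT n) :=
  Submodule.span ℂ {x | ∃ I : Finset (Fin n), I.card = k ∧ x = Finsupp.single I 1}

/-- The space of singular vectors `Sing W^{⊗n}[n-2k] = {w ∈ W^{⊗n}[n-2k] : e w = 0}`. -/
def sing (n k : ℕ) : Submodule ℂ (WT n) :=
  weight n k ⊓ LinearMap.ker (opE n)

/-- Action of `e` in the `i`-th tensor factor. -/
def eAt {n : ℕ} (i : Fin n) : WT n →ₗ[ℂ] WT n :=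
  mkOp fun I => if i ∈ I then Finsupp.single (I.erase i) 1 else 0

/-- Action of `f` in the `i`-th tensor factor. -/
def fAt {n : ℕ} (i : Fin n) : WT n →ₗ[ℂ] WT n :=
  mkOp fun I => if i ∈ I then 0 else Finsupp.single (insert i I) 1

/-- Action of `h` in the `i`-th tensor factor. -/
def hAt {n : ℕ} (i : Fin n) : WT n →ₗ[ℂ] WT n :=
  mkOp fun I => (if i ∈ I then (-1 : ℂ) else 1) • Finsupp.single I 1

/-- The Casimir operator `Ω = ½ h⊗h + e⊗f + f⊗e` acting in the `m`-th and `j`-th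
tensor factors of `W^{⊗n}`. -/
def Omega {n : ℕ} (m j : Fin n) : WT n →ₗ[ℂ] WT n :=
  (2⁻¹ : ℂ) • (hAt m ∘ₗ hAt j) + eAt m ∘ₗ fAt j + fAt m ∘ₗ eAt j

/-- The reduced Casimir operator `Ω̄ = Ω - ½` acting in the `m`-th and `j`-th factors. -/
def OmegaBar {n : ℕ} (m j : Fin n) : WT n →ₗ[ℂ] WT n :=
  Omega m j - (2⁻¹ : ℂ) • LinearMap.id

/-- The Gaudin Hamiltonian `H_m(u) = ∑_{j ≠ m} Ω_{mj} / (u_m - u_j)`. -/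
def gaudin {n : ℕ} (u : Fin n → ℂ) (m : Fin n) : WT n →ₗ[ℂ] WT n :=
  ∑ j ∈ Finset.univ.erase m, (u m - u j)⁻¹ • Omega m j

/-- The reduced Gaudin Hamiltonian `H̄_m(u) = ∑_{j ≠ m} Ω̄_{mj} / (u_m - u_j)`. -/
def gaudinBar {n : ℕ} (u : Fin n → ℂ) (m : Fin n) : WT n →ₗ[ℂ] WT n :=
  ∑ j ∈ Finset.univ.erase m, (u m - u j)⁻¹ • OmegaBar m j

/-- The set `𝒜` of sequences `α = ({p₁,q₁},…,{p_k,q_k})` of `k` pairwise disjoint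
unordered two-element subsets of `{1,…,n}`, encoded as `k`-tuples of ordered pairs
`(p_i, q_i)` with `p_i < q_i` whose underlying two-element sets are pairwise disjoint. -/
def pairSeqs (n k : ℕ) : Finset (Fin k → Fin n × Fin n) :=
  Finset.univ.filter fun α =>
    (∀ i, (α i).1 < (α i).2) ∧
    ∀ i j, i ≠ j →
      Disjoint ({(α i).1, (α i).2} : Finset (Fin n)) {(α j).1, (α j).2}

/-- Points of `ℝ^{nk}` with coordinates `z_i^{(j)}` indexed by `(i,j) : Fin n × Fin k`. -/
abbrev Pt (n k : ℕ) := Fin n × Fin k → ℝ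

/-- Partial derivative of a function of `z : Pt n k` with respect to the coordinate `v`. -/
def pd {n k : ℕ} (v : Fin n × Fin k) (f : Pt n k → ℝ) : Pt n k → ℝ :=
  fun x => fderiv ℝ f x (Pi.single v 1)

/-- Iterated partial derivative `∂/∂z_{g(1)}^{(1)} ⋯ ∂/∂z_{g(k)}^{(k)}`. -/
def pdSeq {n k : ℕ} (g : Fin k → Fin n) (f : Pt n k → ℝ) : Pt n k → ℝ :=
  (List.finRange k).foldl (fun h j => pd (g j, j) h) f

/-- The differential operator
`∂_I = ∑_{σ ∈ S_k} ∂^k / ∂z_{i_{σ(1)}}^{(1)} ⋯ ∂z_{i_{σ(k)}}^{(k)}`, realized as the sum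
over all bijections `g` from `{1,…,k}` onto the `k`-element subset `I`. -/
def pdI {n k : ℕ} (I : Finset (Fin n)) (f : Pt n k → ℝ) : Pt n k → ℝ :=
  fun x =>
    ∑ g ∈ Finset.univ.filter
        (fun g : Fin k → Fin n => Function.Injective g ∧ ∀ j, g j ∈ I),
      pdSeq g f x

/-- The constant `c₂ = -(n-2k+1)! / (2^k (k-1)! (n-k)!)`. -/
def c2 (n k : ℕ) : ℝ :=
  -((n - 2 * k + 1).factorial : ℝ) /
    (2 ^ k * ((k - 1).factorial : ℝ) * ((n - k).factorial : ℝ))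

/-- The potential of the second kind
`Q = c₂ ∑_{α ∈ 𝒜} ln|z_{p₁}^{(1)} - z_{q₁}^{(1)}| ∏_{i=1}^k (z_{p_i}^{(i)} - z_{q_i}^{(i)})²`. -/
def Qfun (n k : ℕ) (hk : 0 < k) : Pt n k → ℝ := fun z =>
  c2 n k *
    ∑ α ∈ pairSeqs n k,
      Real.log |z ((α ⟨0, hk⟩).1, ⟨0, hk⟩) - z ((α ⟨0, hk⟩).2, ⟨0, hk⟩)| *
        ∏ i : Fin k, (z ((α i).1, i) - z ((α i).2, i)) ^ 2

/-- The sign vector `e_{p.1} - e_{p.2}` of an ordered pair, evaluated at `a`. -/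
def pairSign {n : ℕ} (p : Fin n × Fin n) (a : Fin n) : ℝ :=
  (if a = p.1 then 1 else 0) - (if a = p.2 then 1 else 0)

/-- Contraction of `s` with the antisymmetric vector supported on the factors `p.1`, `p.2`. -/
def pairDiff {n : ℕ} (p : Fin n × Fin n) (s : Finset (Fin n) → ℂ) : Finset (Fin n) → ℂ :=
  fun K => s (insert p.1 K) - s (insert p.2 K)

/-- The value of `s` on the singular vector attached to a sequence of pairs. -/
def pairing {n k : ℕ} (s : Finset (Fin n) → ℂ) (α : Fin k → Fin n × Fin n) : ℂ :=
  ∑ g : Fin k → Fin n, (∏ i, (pairSign (α i) (g i) : ℂ)) * s (Finset.univ.image g)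

/-- Sequences of pairwise disjoint pairs contained in `S`. -/
def pairSeqsIn {n : ℕ} (S : Finset (Fin n)) (k : ℕ) : Finset (Fin k → Fin n × Fin n) :=
  (pairSeqs n k).filter fun α => ∀ i, (α i).1 ∈ S ∧ (α i).2 ∈ S

/-- The increasing pairs of elements of `S`. -/
def pairsIn {n : ℕ} (S : Finset (Fin n)) : Finset (Fin n × Fin n) :=
  (S ×ˢ S).filter fun p => p.1 < p.2

/-- Being annihilated by the operator `e` of the tensor factors in `S`. -/
def IsSingularOn {n : ℕ} (S : Finset (Fin n)) (s : Finset (Fin n) → ℂ) : Prop :=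
  ∀ K ⊆ S, ∑ q ∈ S \ K, s (insert q K) = 0

/-- The ratio between the sum of squares of singular vectors attached to sequences of `k` pairs
in an `N`-element set, and the orthogonal projection. -/
def pairConst : ℕ → ℕ → ℂ
  | _, 0 => 1
  | N, k + 1 => (k + 1) * ((N : ℂ) - k) * pairConst (N - 2) k

theorem sum_pairSign_mul {n : ℕ} (p : Fin n × Fin n) (F : Fin n → ℂ) :
    ∑ a, (pairSign p a : ℂ) * F a = F p.1 - F p.2 := by
  simp [pairSign, sub_mul, Finset.sum_sub_distrib, apply_ite ((↑) : ℝ → ℂ)]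

theorem image_univ_cons {n k : ℕ} (a : Fin n) (g : Fin k → Fin n) :
    Finset.univ.image (Fin.cons a g : Fin (k + 1) → Fin n) =
      insert a (Finset.univ.image g) := by
  ext x
  simp [Fin.exists_fin_succ, eq_comm]

theorem pairing_cons {n k : ℕ} (s : Finset (Fin n) → ℂ) (p : Fin n × Fin n)
    (α : Fin k → Fin n × Fin n) :
    pairing s (Fin.cons p α : Fin (k + 1) → Fin n × Fin n) = pairing (pairDiff p s) α := by
  unfold pairing
  rw [← (Fin.consEquiv fun _ : Fin (k + 1) => Fin n).sum_comp, Fintype.sum_prod_type,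
    Finset.sum_comm]
  refine Finset.sum_congr rfl fun g _ => ?_
  have himage : ∀ a : Fin n, Finset.univ.image
      (Fin.consEquiv (fun _ : Fin (k + 1) => Fin n) (a, g)) =
      insert a (Finset.univ.image g) := fun a => image_univ_cons a g
  simp only [himage, Fin.consEquiv_apply, Fin.prod_univ_succ, Fin.cons_zero, Fin.cons_succ,
    mul_assoc]
  rw [sum_pairSign_mul p fun a => (∏ i, (pairSign (α i) (g i) : ℂ)) *
    s (insert a (Finset.univ.image g)), pairDiff]
  ring

theorem sum_pairSeqsIn_succ {n k : ℕ} {M : Type*} [AddCommMonoid M] (S : Finset (Fin n))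
    (F : (Fin (k + 1) → Fin n × Fin n) → M) :
    ∑ α ∈ pairSeqsIn S (k + 1), F α =
      ∑ p ∈ pairsIn S, ∑ α ∈ pairSeqsIn (S \ {p.1, p.2}) k, F (Fin.cons p α) := by
  rw [Finset.sum_sigma']
  refine Finset.sum_bij' (fun α _ => ⟨α 0, Fin.tail α⟩) (fun x _ => Fin.cons x.1 x.2)
    ?_ ?_ ?_ ?_ ?_
  · intro α hα
    simp only [pairSeqsIn, pairSeqs, pairsIn, Finset.mem_filter, Finset.mem_univ, true_and,
      Finset.mem_sigma, Finset.mem_product, Finset.mem_sdiff, Finset.mem_insert,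
      Finset.mem_singleton, Fin.tail] at hα ⊢
    obtain ⟨⟨h1, h2⟩, h3⟩ := hα
    refine ⟨⟨h3 0, h1 0⟩, ⟨fun i => h1 _, fun i j hij => h2 _ _ (by simpa using hij)⟩,
      fun i => ?_⟩
    have h4 := h2 i.succ 0 (Fin.succ_ne_zero i)
    simp only [Finset.disjoint_left, Finset.mem_insert, Finset.mem_singleton] at h4
    exact ⟨⟨(h3 i.succ).1, h4 (Or.inl rfl)⟩, ⟨(h3 i.succ).2, h4 (Or.inr rfl)⟩⟩
  · rintro ⟨p, α⟩ hα
    simp only [pairSeqsIn, pairSeqs, pairsIn, Finset.mem_filter, Finset.mem_univ, true_and,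
      Finset.mem_sigma, Finset.mem_product, Finset.mem_sdiff, Finset.mem_insert,
      Finset.mem_singleton] at hα ⊢
    obtain ⟨⟨h1, h2⟩, ⟨h3, h4⟩, h5⟩ := hα
    have h6 : ∀ i, Disjoint ({(α i).1, (α i).2} : Finset (Fin n)) {p.1, p.2} := by
      intro i
      have := h5 i
      simp only [Finset.disjoint_left, Finset.mem_insert, Finset.mem_singleton]
      rintro x (rfl | rfl)
      · exact this.1.2
      · exact this.2.2
    refine ⟨⟨Fin.cases h2 h3, Fin.cases (Fin.cases ?_ ?_) fun i => Fin.cases ?_ ?_⟩,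
      Fin.cases h1 fun i => ⟨(h5 i).1.1, (h5 i).2.1⟩⟩
    · simp
    · exact fun i _ => (h6 i).symm
    · exact fun _ => h6 i
    · exact fun j hij => h4 i j (by simpa using hij)
  · intro α _
    exact Fin.cons_self_tail α
  · rintro ⟨p, α⟩ _
    simp
  · intro α _
    simp

/-- A sum over increasing pairs of a symmetrized summand is a sum over ordered pairs. -/
theorem sum_pairsIn_symm {n : ℕ} {M : Type*} [AddCommMonoid M] (S : Finset (Fin n))
    (F : Fin n → Fin n → M) :
    ∑ p ∈ pairsIn S, (F p.1 p.2 + F p.2 p.1) = ∑ a ∈ S, ∑ b ∈ S.erase a, F a b := by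
  have hswap : ∑ p ∈ pairsIn S, F p.2 p.1 =
      ∑ p ∈ (S ×ˢ S).filter (fun p => p.2 < p.1), F p.1 p.2 :=
    Finset.sum_bij' (fun p _ => p.swap) (fun p _ => p.swap)
      (by simp +contextual [pairsIn]) (by simp +contextual [pairsIn]) (by simp) (by simp)
      (by simp)
  have hdisj : Disjoint (pairsIn S) ((S ×ˢ S).filter fun p => p.2 < p.1) := by
    simp only [pairsIn, Finset.disjoint_left, Finset.mem_filter, not_and, not_lt]
    exact fun p hp _ => hp.2.le
  rw [Finset.sum_add_distrib, hswap, ← Finset.sum_union hdisj, Finset.sum_sigma']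
  refine Finset.sum_bij' (fun p _ => ⟨p.1, p.2⟩) (fun x _ => (x.1, x.2)) ?_ ?_
    (by simp) (by simp) (by simp)
  · rintro ⟨a, b⟩ h
    simp only [pairsIn, Finset.mem_union, Finset.mem_filter, Finset.mem_product,
      Finset.mem_sigma, Finset.mem_erase] at h ⊢
    grind
  · rintro ⟨a, b⟩ h
    simp only [pairsIn, Finset.mem_union, Finset.mem_filter, Finset.mem_product,
      Finset.mem_sigma, Finset.mem_erase] at h ⊢
    grind

theorem sum_powersetCard_insert {n k : ℕ} (S : Finset (Fin n)) (F : Finset (Fin n) → ℂ) :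
    ∑ K ∈ S.powersetCard k, ∑ a ∈ S \ K, F (insert a K) =
      (k + 1) * ∑ I ∈ S.powersetCard (k + 1), F I := by
  have h : ∑ I ∈ S.powersetCard (k + 1), ∑ _a ∈ I, F I =
      (k + 1) * ∑ I ∈ S.powersetCard (k + 1), F I := by
    rw [Finset.mul_sum]
    refine Finset.sum_congr rfl fun I hI => ?_
    rw [Finset.sum_const, (Finset.mem_powersetCard.1 hI).2]
    simp
  rw [← h, Finset.sum_sigma', Finset.sum_sigma']
  refine Finset.sum_bij' (fun x _ => ⟨insert x.2 x.1, x.2⟩) (fun x _ => ⟨x.1.erase x.2, x.2⟩)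
    ?_ ?_ ?_ ?_ ?_
  · rintro ⟨K, a⟩ h
    simp only [Finset.mem_sigma, Finset.mem_powersetCard, Finset.mem_sdiff] at h ⊢
    refine ⟨⟨Finset.insert_subset h.2.1 h.1.1, ?_⟩, Finset.mem_insert_self _ _⟩
    rw [Finset.card_insert_of_notMem h.2.2, h.1.2]
  · rintro ⟨K, a⟩ h
    simp only [Finset.mem_sigma, Finset.mem_powersetCard, Finset.mem_sdiff] at h ⊢
    refine ⟨⟨(Finset.erase_subset _ _).trans h.1.1, ?_⟩, h.1.1 h.2, Finset.notMem_erase _ _⟩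
    rw [Finset.card_erase_of_mem h.2, h.1.2, Nat.add_sub_cancel]
  · rintro ⟨K, a⟩ h
    simp only [Finset.mem_sigma, Finset.mem_powersetCard, Finset.mem_sdiff] at h
    simp [Finset.erase_insert h.2.2]
  · rintro ⟨K, a⟩ h
    simp only [Finset.mem_sigma] at h
    simp [Finset.insert_erase h.2]
  · simp

theorem IsSingularOn.pairDiff {n : ℕ} {S : Finset (Fin n)} {s : Finset (Fin n) → ℂ}
    (hs : IsSingularOn S s) {p : Fin n × Fin n} (hp1 : p.1 ∈ S) (hp2 : p.2 ∈ S)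
    (hp : p.1 ≠ p.2) : IsSingularOn (S \ {p.1, p.2}) (pairDiff p s) := by
  intro K hK
  have key : ∀ a b : Fin n, a ∈ S → b ∈ S → a ≠ b → K ⊆ S \ {a, b} →
      ∑ q ∈ (S \ {a, b}) \ K, s (insert a (insert q K)) = -s (insert a (insert b K)) := by
    intro a b ha hb hab hK
    have haK : a ∉ K := fun h => by simpa using hK h
    have hbK : b ∉ K := fun h => by simpa using hK h
    have h1 := hs (insert a K) (Finset.insert_subset ha (hK.trans Finset.sdiff_subset))
    have h2 : S \ insert a K = insert b ((S \ {a, b}) \ K) := by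
      ext x
      simp only [Finset.mem_sdiff, Finset.mem_insert, Finset.mem_singleton]
      grind
    rw [h2, Finset.sum_insert (by simp)] at h1
    simp only [Finset.insert_comm _ a] at h1
    exact eq_neg_of_add_eq_zero_right h1
  have hcomm : ({p.2, p.1} : Finset (Fin n)) = {p.1, p.2} := Finset.pair_comm _ _
  have h2 := key p.2 p.1 hp2 hp1 hp.symm (by rwa [hcomm])
  rw [hcomm] at h2
  simp only [_root_.pairDiff, Finset.sum_sub_distrib]
  rw [key p.1 p.2 hp1 hp2 hp hK, h2, Finset.insert_comm, sub_self]

/-- The quadratic Casimir acts on singular vectors by a scalar. -/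
theorem sum_pairsIn_pairDiff {n k : ℕ} (S : Finset (Fin n)) (s t : Finset (Fin n) → ℂ)
    (ht : IsSingularOn S t) :
    ∑ p ∈ pairsIn S, ∑ K ∈ (S \ {p.1, p.2}).powersetCard k, pairDiff p s K * pairDiff p t K =
      (k + 1) * ((S.card : ℂ) - k) * ∑ I ∈ S.powersetCard (k + 1), s I * t I := by
  let F : Fin n → Fin n → ℂ := fun a b => ∑ K ∈ (S \ {a, b}).powersetCard k,
    s (insert a K) * (t (insert a K) - t (insert b K))
  have h1 : ∀ p : Fin n × Fin n, ∑ K ∈ (S \ {p.1, p.2}).powersetCard k,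
      pairDiff p s K * pairDiff p t K = F p.1 p.2 + F p.2 p.1 := by
    intro p
    simp only [F, Finset.pair_comm p.2 p.1]
    rw [← Finset.sum_add_distrib]
    refine Finset.sum_congr rfl fun K _ => ?_
    simp only [pairDiff]
    ring
  have h2 : ∑ a ∈ S, ∑ b ∈ S.erase a, F a b = ∑ K ∈ S.powersetCard k, ∑ a ∈ S \ K,
      ∑ b ∈ S \ insert a K, s (insert a K) * (t (insert a K) - t (insert b K)) := by
    simp only [F, Finset.sum_sigma']
    refine Finset.sum_bij' (fun x _ => ⟨x.2.2, x.1, x.2.1⟩)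
      (fun x _ => ⟨x.2.1, x.2.2, x.1⟩) ?_ ?_ (by simp) (by simp) (by simp)
    · rintro ⟨a, b, K⟩ h
      simp only [Finset.mem_sigma, Finset.mem_powersetCard, Finset.mem_sdiff, Finset.mem_erase,
        Finset.subset_iff, Finset.mem_insert, Finset.mem_singleton] at h ⊢
      grind
    · rintro ⟨K, a, b⟩ h
      simp only [Finset.mem_sigma, Finset.mem_powersetCard, Finset.mem_sdiff, Finset.mem_erase,
        Finset.subset_iff, Finset.mem_insert, Finset.mem_singleton] at h ⊢
      grind
  rw [Finset.sum_congr rfl fun p _ => h1 p, sum_pairsIn_symm, h2]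
  have h3 : ∀ K ∈ S.powersetCard k, ∀ a ∈ S \ K,
      ∑ b ∈ S \ insert a K, s (insert a K) * (t (insert a K) - t (insert b K)) =
        ((S.card : ℂ) - k) * (s (insert a K) * t (insert a K)) := by
    intro K hK a ha
    obtain ⟨hKS, hKc⟩ := Finset.mem_powersetCard.1 hK
    have ht' := ht K hKS
    have h4 : S \ K = insert a (S \ insert a K) := by
      ext x
      simp only [Finset.mem_sdiff, Finset.mem_insert] at ha ⊢
      grind
    have h5 : a ∉ S \ insert a K := by simp
    have hcard : ((S \ insert a K).card : ℂ) = (S.card : ℂ) - k - 1 := by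
      have h6 := congrArg Finset.card h4
      rw [Finset.card_insert_of_notMem h5, Finset.card_sdiff_of_subset hKS, hKc] at h6
      have h7 : k ≤ S.card := hKc ▸ Finset.card_le_card hKS
      have h8 : (S \ insert a K).card + 1 + k = S.card := by omega
      rw [← h8]
      push_cast
      ring
    rw [h4, Finset.sum_insert h5] at ht'
    rw [← Finset.mul_sum, Finset.sum_sub_distrib, Finset.sum_const, nsmul_eq_mul, hcard,
      eq_neg_of_add_eq_zero_right ht']
    ring
  rw [Finset.sum_congr rfl fun K hK => Finset.sum_congr rfl (h3 K hK)]
  simp only [← Finset.mul_sum]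
  rw [sum_powersetCard_insert S fun I => s I * t I]
  ring

/-- The singular vectors attached to sequences of pairs form a tight frame. -/
theorem sum_pairing_mul_pairing {n : ℕ} (k : ℕ) (S : Finset (Fin n))
    (s t : Finset (Fin n) → ℂ) (ht : IsSingularOn S t) :
    ∑ α ∈ pairSeqsIn S k, pairing s α * pairing t α =
      pairConst S.card k * ∑ I ∈ S.powersetCard k, s I * t I := by
  induction k generalizing S s t with
  | zero =>
    have : pairSeqsIn S 0 = Finset.univ := by
      simp [pairSeqsIn, pairSeqs, Finset.filter_true_of_mem]
    simp [this, pairing, pairConst]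
  | succ k ih =>
    rw [sum_pairSeqsIn_succ]
    simp only [pairing_cons]
    have h : ∀ p ∈ pairsIn S, ∑ α ∈ pairSeqsIn (S \ {p.1, p.2}) k,
        pairing (pairDiff p s) α * pairing (pairDiff p t) α =
        pairConst (S.card - 2) k *
          ∑ K ∈ (S \ {p.1, p.2}).powersetCard k, pairDiff p s K * pairDiff p t K := by
      intro p hp
      simp only [pairsIn, Finset.mem_filter, Finset.mem_product] at hp
      rw [ih _ _ _ (ht.pairDiff hp.1.1 hp.1.2 hp.2.ne), Finset.card_sdiff_of_subset
        (by simp [Finset.insert_subset_iff, hp.1]), Finset.card_pair hp.2.ne]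
    rw [Finset.sum_congr rfl h, ← Finset.mul_sum, sum_pairsIn_pairDiff S s t ht, pairConst]
    ring

theorem c2_mul_pairConst {n k : ℕ} (hn : 2 * (k + 1) ≤ n) :
    (c2 n (k + 1) : ℂ) * 2 ^ (k + 1) * pairConst (n - 2) k = -1 := by
  have key : ∀ k N : ℕ, 2 * k ≤ N →
      pairConst N k * ((N - 2 * k + 1).factorial : ℂ) =
        (k.factorial : ℂ) * ((N - k + 1).factorial : ℂ) := by
    intro k
    induction k with
    | zero => intro N _; simp [pairConst]
    | succ k ih =>
      intro N hN
      have h1 := ih (N - 2) (by omega)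
      obtain ⟨M, rfl⟩ : ∃ M, N = M + 2 * k + 2 := ⟨N - (2 * k + 2), by omega⟩
      have e1 : M + 2 * k + 2 - 2 - 2 * k + 1 = M + 1 := by omega
      have e2 : M + 2 * k + 2 - 2 - k + 1 = M + k + 1 := by omega
      have e3 : M + 2 * k + 2 - 2 * (k + 1) + 1 = M + 1 := by omega
      have e4 : M + 2 * k + 2 - (k + 1) + 1 = M + k + 1 + 1 := by omega
      rw [e1, e2] at h1
      rw [e3, e4, pairConst, mul_assoc, h1, Nat.factorial_succ k,
        Nat.factorial_succ (M + k + 1)]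
      push_cast
      ring
  have h := key k (n - 2) (by omega)
  have e1 : n - 2 - 2 * k + 1 = n - 2 * (k + 1) + 1 := by omega
  have e2 : n - 2 - k + 1 = n - (k + 1) := by omega
  rw [e1, e2] at h
  have h1 : (k.factorial : ℂ) ≠ 0 := by exact_mod_cast k.factorial_ne_zero
  have h2 : ((n - (k + 1)).factorial : ℂ) ≠ 0 := by exact_mod_cast Nat.factorial_ne_zero _
  simp only [c2, Nat.add_sub_cancel]
  push_cast
  field_simp
  linear_combination -h

/-- The difference `z_{p_i}^{(i)} - z_{q_i}^{(i)}`. -/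
def pairGap {n k : ℕ} (α : Fin k → Fin n × Fin n) (i : Fin k) (z : Pt n k) : ℝ :=
  z ((α i).1, i) - z ((α i).2, i)

/-- The derivatives of `x ↦ x ^ 2`. -/
def sqDeriv : ℕ → ℝ → ℝ
  | 0, x => x ^ 2
  | 1, x => 2 * x
  | 2, _ => 2
  | _ + 3, _ => 0

/-- The derivatives of `x ↦ x ^ 2 * log x` away from the origin. -/
def sqLogDeriv : ℕ → ℝ → ℝ
  | 0, x => x ^ 2 * Real.log x
  | 1, x => 2 * x * Real.log x + x
  | 2, x => 2 * Real.log x + 3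
  | d + 3, x => 2 * ((-1) ^ d * d.factorial) * x⁻¹ ^ (d + 1)

/-- The derivatives of the factor with index `i` in the summands of the potential. -/
def factorDeriv {k : ℕ} (i : Fin (k + 1)) (d : ℕ) : ℝ → ℝ :=
  if i = 0 then sqLogDeriv d else sqDeriv d

/-- Linear combinations of products of derivatives of the factors of the potential. -/
def factorSum {n k : ℕ} (w : (Fin (k + 1) → Fin n × Fin n) → ℝ) (d : Fin (k + 1) → ℕ)
    (z : Pt n (k + 1)) : ℝ :=
  ∑ α ∈ pairSeqs n (k + 1), w α * ∏ i, factorDeriv i (d i) (pairGap α i z)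

/-- The points whose first row of coordinates is pairwise distinct. -/
def distinctPts (n k : ℕ) : Set (Pt n (k + 1)) :=
  {z | Function.Injective fun i : Fin n => z (i, 0)}

theorem isOpen_distinctPts (n k : ℕ) : IsOpen (distinctPts n k) := by
  have : distinctPts n k = ⋂ i : Fin n, ⋂ j : Fin n, {z | i ≠ j → z (i, 0) ≠ z (j, 0)} := by
    ext z
    simp only [distinctPts, Function.Injective, Set.mem_ofPred_eq, Set.mem_iInter]
    exact forall₂_congr fun i j => not_imp_not.symm
  rw [this]
  refine isOpen_iInter_of_finite fun i => isOpen_iInter_of_finite fun j => ?_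
  by_cases hij : i = j
  · simp [hij]
  · simpa [hij] using isOpen_ne_fun (continuous_apply (i, (0 : Fin (k + 1))))
      (continuous_apply (j, (0 : Fin (k + 1))))

theorem hasDerivAt_sqDeriv (d : ℕ) (x : ℝ) : HasDerivAt (sqDeriv d) (sqDeriv (d + 1) x) x := by
  match d with
  | 0 => exact (hasDerivAt_pow 2 x).congr_deriv (by simp [sqDeriv])
  | 1 => exact ((hasDerivAt_id x).const_mul 2).congr_deriv (by simp [sqDeriv])
  | 2 => exact hasDerivAt_const x 2
  | d + 3 => exact hasDerivAt_const x 0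

theorem hasDerivAt_sqLogDeriv (d : ℕ) {x : ℝ} (hx : x ≠ 0) :
    HasDerivAt (sqLogDeriv d) (sqLogDeriv (d + 1) x) x := by
  have hlog := Real.hasDerivAt_log hx
  match d with
  | 0 =>
    refine ((hasDerivAt_pow 2 x).mul hlog).congr_deriv ?_
    simp only [sqLogDeriv]
    field_simp
    push_cast
    ring
  | 1 =>
    refine ((((hasDerivAt_id x).const_mul 2).mul hlog).add (hasDerivAt_id x)).congr_deriv ?_
    simp only [sqLogDeriv, id]
    field_simp
    ring
  | 2 =>
    refine ((hlog.const_mul 2).add_const 3).congr_deriv ?_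
    simp [sqLogDeriv]
  | d + 3 =>
    refine (((hasDerivAt_inv hx).pow (d + 1)).const_mul
      (2 * ((-1) ^ d * d.factorial) : ℝ)).congr_deriv ?_
    simp only [sqLogDeriv, Nat.factorial_succ]
    push_cast
    have h : (x ^ 2)⁻¹ = x⁻¹ ^ 2 := by simp
    simp only [h]
    ring

theorem hasDerivAt_factorDeriv {k : ℕ} (i : Fin (k + 1)) (d : ℕ) {x : ℝ}
    (hx : i = 0 → x ≠ 0) : HasDerivAt (factorDeriv i d) (factorDeriv i (d + 1) x) x := by
  unfold factorDeriv
  split_ifs with h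
  · exact hasDerivAt_sqLogDeriv d (hx h)
  · exact hasDerivAt_sqDeriv d x

theorem pairGap_ne_zero {n k : ℕ} {α : Fin (k + 1) → Fin n × Fin n}
    (hα : α ∈ pairSeqs n (k + 1)) {z : Pt n (k + 1)} (hz : z ∈ distinctPts n k) :
    pairGap α 0 z ≠ 0 := by
  simp only [pairSeqs, Finset.mem_filter, Finset.mem_univ, true_and] at hα
  exact sub_ne_zero.2 fun h => (hα.1 0).ne (hz h)

theorem pd_congr {n k : ℕ} (v : Fin n × Fin (k + 1)) {f g : Pt n (k + 1) → ℝ}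
    (h : Set.EqOn f g (distinctPts n k)) : Set.EqOn (pd v f) (pd v g) (distinctPts n k) := by
  intro z hz
  have : f =ᶠ[nhds z] g := h.eventuallyEq_of_mem ((isOpen_distinctPts n k).mem_nhds hz)
  simp only [pd, this.fderiv_eq]

theorem pd_factorSum {n k : ℕ} (w : (Fin (k + 1) → Fin n × Fin n) → ℝ)
    (d : Fin (k + 1) → ℕ) (a : Fin n) (j : Fin (k + 1)) :
    Set.EqOn (pd (a, j) (factorSum w d))
      (factorSum (fun α => w α * pairSign (α j) a) (d + Pi.single j 1)) (distinctPts n k) := by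
  intro z hz
  have hgap : ∀ (α : Fin (k + 1) → Fin n × Fin n) (i : Fin (k + 1)),
      HasFDerivAt (pairGap α i)
        (ContinuousLinearMap.proj (R := ℝ) (φ := fun _ : Fin n × Fin (k + 1) => ℝ) ((α i).1, i) -
          ContinuousLinearMap.proj (R := ℝ) (φ := fun _ : Fin n × Fin (k + 1) => ℝ) ((α i).2, i))
        z := fun α i =>
    (hasFDerivAt_apply ((α i).1, i) z).sub (hasFDerivAt_apply ((α i).2, i) z)
  have hfac : ∀ α ∈ pairSeqs n (k + 1), ∀ i, HasFDerivAt
      (fun z => factorDeriv i (d i) (pairGap α i z))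
      (factorDeriv i (d i + 1) (pairGap α i z) •
        (ContinuousLinearMap.proj (R := ℝ) (φ := fun _ : Fin n × Fin (k + 1) => ℝ) ((α i).1, i) -
          ContinuousLinearMap.proj (R := ℝ) (φ := fun _ : Fin n × Fin (k + 1) => ℝ) ((α i).2, i)))
      z := fun α hα i => (hasDerivAt_factorDeriv i (d i)
        (by rintro rfl; exact pairGap_ne_zero hα hz)).comp_hasFDerivAt z (hgap α i)
  have hsum := HasFDerivAt.fun_sum fun α hα =>
    (HasFDerivAt.finsetProd (u := Finset.univ) fun i _ => hfac α hα i).const_mul (w α)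
  have hfd : fderiv ℝ (factorSum w d) z = _ := hsum.fderiv
  simp only [pd, hfd, factorSum, sum_apply, smul_apply, sub_apply, ContinuousLinearMap.proj_apply, smul_eq_mul]
  refine Finset.sum_congr rfl fun α _ => ?_
  rw [mul_assoc]
  congr 1
  rw [Finset.sum_eq_single j]
  · rw [← Finset.mul_prod_erase Finset.univ _ (Finset.mem_univ j)]
    have hrest : ∏ i ∈ Finset.univ.erase j, factorDeriv i ((d + Pi.single j 1 : Fin (k + 1) → ℕ) i)
        (pairGap α i z) = ∏ i ∈ Finset.univ.erase j, factorDeriv i (d i) (pairGap α i z) :=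
      Finset.prod_congr rfl fun i hi => by simp [Finset.ne_of_mem_erase hi]
    rw [hrest]
    simp [pairSign, Pi.single_apply, eq_comm (a := a)]
    ring
  · intro i _ hij
    simp [hij]
  · simp

theorem foldl_pd_factorSum {n k : ℕ} (g : Fin (k + 1) → Fin n) (l : List (Fin (k + 1)))
    (w : (Fin (k + 1) → Fin n × Fin n) → ℝ) (d : Fin (k + 1) → ℕ) (f : Pt n (k + 1) → ℝ)
    (hf : Set.EqOn f (factorSum w d) (distinctPts n k)) :
    Set.EqOn (l.foldl (fun h j => pd (g j, j) h) f)
      (factorSum (fun α => w α * (l.map fun j => pairSign (α j) (g j)).prod)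
        (d + (l.map fun j => Pi.single j 1).sum)) (distinctPts n k) := by
  induction l generalizing w d f with
  | nil => simpa using hf
  | cons j l ih =>
    have h := ih _ _ _ ((pd_congr (g j, j) hf).trans (pd_factorSum w d (g j) j))
    simpa [mul_assoc, add_assoc] using h

theorem pdI_factorSum {n k : ℕ} (I : Finset (Fin n)) (w : (Fin (k + 1) → Fin n × Fin n) → ℝ)
    (d : Fin (k + 1) → ℕ) (f : Pt n (k + 1) → ℝ)
    (hf : Set.EqOn f (factorSum w d) (distinctPts n k)) :
    Set.EqOn (pdI I f) (factorSum (fun α => w α * ∑ g ∈ Finset.univ.filter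
        (fun g : Fin (k + 1) → Fin n => Function.Injective g ∧ ∀ j, g j ∈ I),
        ∏ j, pairSign (α j) (g j)) (d + 1)) (distinctPts n k) := by
  intro z hz
  have hd : ((List.finRange (k + 1)).map fun j => (Pi.single j 1 : Fin (k + 1) → ℕ)).sum = 1 := by
    rw [← Fin.sum_univ_def]
    exact Finset.univ_sum_single (1 : Fin (k + 1) → ℕ)
  have h : ∀ g : Fin (k + 1) → Fin n, pdSeq g f z =
      factorSum (fun α => w α * ∏ j, pairSign (α j) (g j)) (d + 1) z := by
    intro g
    have := foldl_pd_factorSum g (List.finRange (k + 1)) w d f hf hz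
    rw [hd] at this
    simpa [pdSeq, Fin.prod_univ_def] using this
  simp only [pdI, h, factorSum, Finset.mul_sum, Finset.sum_mul]
  exact Finset.sum_comm

theorem Qfun_eq_factorSum (n k : ℕ) :
    Qfun n (k + 1) k.succ_pos = factorSum (fun _ => c2 n (k + 1)) 0 := by
  funext z
  simp only [Qfun, factorSum, Finset.mul_sum]
  refine Finset.sum_congr rfl fun α _ => ?_
  simp [Fin.prod_univ_succ, factorDeriv, sqDeriv, sqLogDeriv, pairGap, Fin.succ_ne_zero]
  left
  ring

/-- The right-hand side of the main identity as an explicit sum. -/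
theorem pd_pdI_pdI_Qfun {n k : ℕ} (I J : Finset (Fin n)) (m : Fin n) {z : Pt n (k + 1)}
    (hz : z ∈ distinctPts n k) :
    pd (m, 0) (pdI I (pdI J (Qfun n (k + 1) k.succ_pos))) z =
      ∑ α ∈ pairSeqs n (k + 1), c2 n (k + 1) * 2 ^ (k + 1) *
        ((∑ g ∈ Finset.univ.filter
          (fun g : Fin (k + 1) → Fin n => Function.Injective g ∧ ∀ j, g j ∈ I),
          ∏ j, pairSign (α j) (g j)) *
        (∑ g ∈ Finset.univ.filter
          (fun g : Fin (k + 1) → Fin n => Function.Injective g ∧ ∀ j, g j ∈ J),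
          ∏ j, pairSign (α j) (g j))) *
        (pairSign (α 0) m * (z ((α 0).1, 0) - z ((α 0).2, 0))⁻¹) := by
  rw [Qfun_eq_factorSum, pd_congr (m, 0) (pdI_factorSum I _ _ _
    (pdI_factorSum J _ _ _ fun _ _ => rfl)) hz, pd_factorSum _ _ _ _ hz, factorSum]
  refine Finset.sum_congr rfl fun α _ => ?_
  simp [Fin.prod_univ_succ, factorDeriv, sqDeriv, sqLogDeriv, pairGap, Fin.succ_ne_zero]
  ring

theorem mkOp_single {n : ℕ} (φ : Finset (Fin n) → WT n) (I : Finset (Fin n)) :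
    mkOp φ (Finsupp.single I 1) = φ I := by
  simp [mkOp]

theorem linearMap_apply_eq_sum {n : ℕ} (T : WT n →ₗ[ℂ] WT n) (x : WT n) :
    T x = ∑ L, x L • T (Finsupp.single L 1) := by
  conv_lhs => rw [← Finsupp.univ_sum_single x]
  simp only [map_sum, ← map_smul, Finsupp.smul_single, smul_eq_mul, mul_one]

theorem shap_eq_sum {n : ℕ} (x y : WT n) : shap x y = ∑ L, x L * y L :=
  Finsupp.sum_fintype _ _ (by simp)

/-- The Shapovalov form as a bilinear map. -/
def shapBilin (n : ℕ) : WT n →ₗ[ℂ] WT n →ₗ[ℂ] ℂ :=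
  LinearMap.mk₂ ℂ shap
    (by simp [shap_eq_sum, add_mul, Finset.sum_add_distrib])
    (by simp [shap_eq_sum, Finset.mul_sum, mul_assoc])
    (by simp [shap_eq_sum, mul_add, Finset.sum_add_distrib])
    (by simp [shap_eq_sum, Finset.mul_sum, mul_left_comm])

theorem shapBilin_apply {n : ℕ} (x y : WT n) : shapBilin n x y = shap x y := rfl

theorem shap_single {n : ℕ} (L : Finset (Fin n)) (y : WT n) :
    shap (Finsupp.single L 1) y = y L := by
  simp [shap]

/-- The reduced Casimir operator is minus the rank-one form given by the antisymmetric vector. -/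
theorem shap_OmegaBar {n : ℕ} {m j : Fin n} (hmj : m ≠ j) (x y : WT n) :
    shap (OmegaBar m j x) y =
      -∑ K ∈ (Finset.univ \ {m, j}).powerset, pairDiff (m, j) x K * pairDiff (m, j) y K := by
  have huniv : (Finset.univ : Finset (Finset (Fin n))) =
      (insert m (insert j (Finset.univ \ {m, j}))).powerset := by
    rw [← Finset.powerset_univ]
    congr 1
    ext a
    simp only [Finset.mem_univ, Finset.mem_insert, Finset.mem_sdiff, Finset.mem_singleton]
    tauto
  rw [linearMap_apply_eq_sum, ← shapBilin_apply]
  simp only [map_sum, map_smul, LinearMap.sum_apply, LinearMap.smul_apply, shapBilin_apply,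
    smul_eq_mul]
  rw [huniv, Finset.sum_powerset_insert (by simp [hmj]), Finset.sum_powerset_insert (by simp),
    Finset.sum_powerset_insert (by simp), ← Finset.sum_add_distrib, ← Finset.sum_add_distrib,
    ← Finset.sum_add_distrib, ← Finset.sum_neg_distrib]
  refine Finset.sum_congr rfl fun K hK => ?_
  have hm : m ∉ K := fun h => by simpa using Finset.mem_powerset.1 hK h
  have hj : j ∉ K := fun h => by simpa using Finset.mem_powerset.1 hK h
  have h0 : OmegaBar m j (Finsupp.single K 1) = 0 := by
    simp [OmegaBar, Omega, hAt, eAt, fAt, mkOp_single, hm, hj, hmj]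
  have h1 : OmegaBar m j (Finsupp.single (insert j K) 1) =
      Finsupp.single (insert m K) 1 - Finsupp.single (insert j K) 1 := by
    simp [OmegaBar, Omega, hAt, eAt, fAt, mkOp_single, hm, hj, hmj,
      -Finsupp.smul_single]
    module
  have h2 : OmegaBar m j (Finsupp.single (insert m K) 1) =
      Finsupp.single (insert j K) 1 - Finsupp.single (insert m K) 1 := by
    have herase : (insert j (insert m K)).erase m = insert j K := by
      rw [Finset.insert_comm, Finset.erase_insert (by simp [hm, hmj])]
    simp [OmegaBar, Omega, hAt, eAt, fAt, mkOp_single, hm, hj, hmj, hmj.symm, herase,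
      -Finsupp.smul_single]
    module
  have h3 : OmegaBar m j (Finsupp.single (insert m (insert j K)) 1) = 0 := by
    simp [OmegaBar, Omega, hAt, eAt, fAt, mkOp_single, hm, hj, hmj]
  rw [h0, h1, h2, h3]
  simp only [← shapBilin_apply, map_sub, LinearMap.sub_apply, map_zero, LinearMap.zero_apply]
  simp only [shapBilin_apply, shap_single, pairDiff]
  ring

theorem opE_apply {n : ℕ} (x : WT n) (K : Finset (Fin n)) :
    opE n x K = ∑ q ∈ Finset.univ \ K, x (insert q K) := by
  rw [linearMap_apply_eq_sum]
  simp only [opE, mkOp_single, Finsupp.coe_finsetSum, Finset.sum_apply, Finsupp.smul_apply,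
    smul_eq_mul, Finset.mul_sum, Finsupp.single_apply, mul_ite, mul_one, mul_zero]
  rw [Finset.sum_sigma', ← Finset.sum_filter]
  refine Finset.sum_bij' (fun x _ => x.2) (fun q _ => ⟨insert q K, q⟩) ?_ ?_ ?_ ?_ ?_
  · rintro ⟨L, i⟩ h
    simp only [Finset.mem_filter] at h
    simp [← h.2]
  · intro q h
    simpa using h
  · rintro ⟨L, i⟩ h
    simp only [Finset.mem_filter, Finset.mem_sigma] at h
    simp [← h.2, Finset.insert_erase h.1.2]
  · simp
  · rintro ⟨L, i⟩ h
    simp only [Finset.mem_filter, Finset.mem_sigma] at h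
    simp [← h.2, Finset.insert_erase h.1.2]

theorem isSingularOn_univ_of_mem_sing {n k : ℕ} {x : WT n} (hx : x ∈ sing n k) :
    IsSingularOn Finset.univ x := by
  intro K _
  rw [← opE_apply, LinearMap.mem_ker.1 hx.2, Finsupp.zero_apply]

theorem apply_eq_zero_of_mem_weight {n k : ℕ} {x : WT n} (hx : x ∈ weight n k)
    {L : Finset (Fin n)} (hL : L.card ≠ k) : x L = 0 := by
  induction hx using Submodule.span_induction with
  | mem x hx =>
    obtain ⟨I, hI, rfl⟩ := hx
    exact Finsupp.single_eq_of_ne (by rintro rfl; exact hL hI)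
  | zero => rfl
  | add x y _ _ hx hy => simp [hx, hy]
  | smul a x _ hx => simp [hx]

theorem single_mem_weight {n k : ℕ} {I : Finset (Fin n)} (hI : I.card = k) :
    Finsupp.single I 1 ∈ weight n k :=
  Submodule.subset_span ⟨I, hI, rfl⟩

/-- The singular vector attached to a sequence of pairs. -/
def pairVec {n k : ℕ} (α : Fin k → Fin n × Fin n) : WT n :=
  ∑ g : Fin k → Fin n, (∏ i, (pairSign (α i) (g i) : ℂ)) •
    Finsupp.single (Finset.univ.image g) 1

theorem shap_pairVec {n k : ℕ} (x : WT n) (α : Fin k → Fin n × Fin n) :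
    shap x (pairVec α) = pairing x α := by
  have h : ∀ L, shap x (Finsupp.single L 1) = x L := by
    intro L
    simp [shap_eq_sum, Finsupp.single_apply]
  rw [← shapBilin_apply, pairVec]
  simp only [map_sum, map_smul, shapBilin_apply, h, pairing, smul_eq_mul]

theorem injective_of_prod_pairSign_ne_zero {n k : ℕ} {α : Fin k → Fin n × Fin n}
    (hα : α ∈ pairSeqs n k) {g : Fin k → Fin n} (hg : ∏ i, (pairSign (α i) (g i) : ℂ) ≠ 0) :
    Function.Injective g := by
  have hmem : ∀ i, g i ∈ ({(α i).1, (α i).2} : Finset (Fin n)) := by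
    intro i
    by_contra h
    simp only [Finset.mem_insert, Finset.mem_singleton, not_or] at h
    exact Finset.prod_ne_zero_iff.1 hg i (Finset.mem_univ i) (by simp [pairSign, h])
  simp only [pairSeqs, Finset.mem_filter, Finset.mem_univ, true_and] at hα
  intro i j hij
  by_contra h
  exact Finset.disjoint_left.1 (hα.2 i j h) (hmem i) (hij ▸ hmem j)

theorem opE_pairVec {n k : ℕ} {α : Fin (k + 1) → Fin n × Fin n}
    (hα : α ∈ pairSeqs n (k + 1)) : opE n (pairVec α) = 0 := by
  have h : ∀ g : Fin (k + 1) → Fin n, (∏ i, (pairSign (α i) (g i) : ℂ)) •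
      opE n (Finsupp.single (Finset.univ.image g) 1) =
      ∑ j, (∏ i, (pairSign (α i) (g i) : ℂ)) •
        Finsupp.single ((Finset.univ.erase j).image g) 1 := by
    intro g
    by_cases h0 : ∏ i, (pairSign (α i) (g i) : ℂ) = 0
    · simp [h0]
    have hg := injective_of_prod_pairSign_ne_zero hα h0
    rw [opE, mkOp_single, Finset.sum_image hg.injOn, Finset.smul_sum]
    simp only [Finset.image_erase hg]
  simp only [pairVec, map_sum, map_smul, h]
  rw [Finset.sum_comm]
  refine Finset.sum_eq_zero fun j _ => ?_
  rw [← (Fin.insertNthEquiv (fun _ : Fin (k + 1) => Fin n) j).sum_comp, Fintype.sum_prod_type,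
    Finset.sum_comm]
  refine Finset.sum_eq_zero fun g _ => ?_
  have himage : ∀ a : Fin n, (Finset.univ.erase j).image
      (Fin.insertNthEquiv (fun _ : Fin (k + 1) => Fin n) j (a, g)) = Finset.univ.image g := by
    intro a
    ext b
    simp [Fin.exists_iff_succAbove j]
  simp only [himage, Fin.prod_univ_succAbove _ j, ← Finset.sum_smul]
  simp [← Finset.sum_mul, pairSign, Finset.sum_sub_distrib, apply_ite ((↑) : ℝ → ℂ)]

theorem pairVec_mem_sing {n k : ℕ} {α : Fin (k + 1) → Fin n × Fin n}
    (hα : α ∈ pairSeqs n (k + 1)) : pairVec α ∈ sing n (k + 1) := by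
  refine ⟨Submodule.sum_mem _ fun g _ => ?_, opE_pairVec hα⟩
  by_cases h0 : ∏ i, (pairSign (α i) (g i) : ℂ) = 0
  · simp [h0]
  · refine Submodule.smul_mem _ _ (single_mem_weight ?_)
    rw [Finset.card_image_of_injective _ (injective_of_prod_pairSign_ne_zero hα h0)]
    simp

theorem sum_injective_prod_pairSign {n k : ℕ} {I : Finset (Fin n)} (hI : I.card = k)
    (α : Fin k → Fin n × Fin n) :
    ((∑ g ∈ Finset.univ.filter (fun g : Fin k → Fin n => Function.Injective g ∧ ∀ j, g j ∈ I),
      ∏ j, pairSign (α j) (g j) : ℝ) : ℂ) = pairing (Finsupp.single I 1 : WT n) α := by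
  have h : ∀ g : Fin k → Fin n,
      (Function.Injective g ∧ ∀ j, g j ∈ I) ↔ I = Finset.univ.image g := by
    intro g
    constructor
    · rintro ⟨hg, hgI⟩
      symm
      refine Finset.eq_of_subset_of_card_le (Finset.image_subset_iff.2 fun j _ => hgI j) ?_
      rw [Finset.card_image_of_injective _ hg, hI, Finset.card_fin]
    · rintro rfl
      refine ⟨Set.injOn_univ.1 ?_, by simp⟩
      rw [← Finset.coe_univ, ← Finset.card_image_iff, hI, Finset.card_fin]
  simp only [pairing, h, Finsupp.single_apply, mul_ite, mul_one, mul_zero]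
  push_cast
  rw [Finset.sum_filter]

theorem pairDiff_swap {n : ℕ} (a b : Fin n) (s : Finset (Fin n) → ℂ) (K : Finset (Fin n)) :
    pairDiff (b, a) s K = -pairDiff (a, b) s K := by
  simp [pairDiff]

/-- for real `z = (z_i^{(j)})` with `z_1^{(1)},…,z_n^{(1)}` pairwise
distinct, for `k`-element subsets `I, J` and any `m`,
`(H̄_m(z^{(1)}) v_I, v_J) = ∂/∂z_m^{(1)} ∂_I ∂_J Q (z)`. -/
theorem stmt13 (n k : ℕ) (hk : 1 ≤ k) (hn : 2 * k ≤ n)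
    (π : WT n →ₗ[ℂ] WT n)
    (hrange : ∀ x ∈ weight n k, π x ∈ sing n k)
    (hfix : ∀ x ∈ sing n k, π x = x)
    (horth : ∀ x ∈ weight n k, ∀ s ∈ sing n k, shap (x - π x) s = 0)
    (z : Pt n k) (hz : Function.Injective fun i : Fin n => z (i, ⟨0, hk⟩))
    (I J : Finset (Fin n)) (hI : I.card = k) (hJ : J.card = k) (m : Fin n) :
    shap
        (gaudinBar (fun i : Fin n => ((z (i, ⟨0, hk⟩) : ℝ) : ℂ)) m
          (π (Finsupp.single I 1)))
        (π (Finsupp.single J 1)) =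
      ((pd (m, ⟨0, hk⟩) (pdI I (pdI J (Qfun n k hk))) z : ℝ) : ℂ) := by
  obtain ⟨k, rfl⟩ : ∃ l, k = l + 1 := ⟨k - 1, by omega⟩
  have hz' : z ∈ distinctPts n k := hz
  set x := π (Finsupp.single I 1) with hx
  set y := π (Finsupp.single J 1) with hy
  have hxs : x ∈ sing n (k + 1) := hrange _ (single_mem_weight hI)
  have hys : y ∈ sing n (k + 1) := hrange _ (single_mem_weight hJ)
  have hproj : ∀ L : Finset (Fin n), L.card = k + 1 → ∀ α ∈ pairSeqs n (k + 1),
      pairing (Finsupp.single L 1 : WT n) α = pairing (π (Finsupp.single L 1)) α := by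
    intro L hL α hα
    have h := horth _ (single_mem_weight hL) _ (pairVec_mem_sing hα)
    rw [← shapBilin_apply, map_sub, LinearMap.sub_apply, sub_eq_zero, shapBilin_apply,
      shapBilin_apply, shap_pairVec, shap_pairVec] at h
    exact h
  let B : Fin n → Fin n → ℂ := fun a b => ∑ K ∈ (Finset.univ \ {a, b}).powersetCard k,
    pairDiff (a, b) x K * pairDiff (a, b) y K
  have hB : ∀ a b, B b a = B a b := by
    intro a b
    simp only [B, Finset.pair_comm b a, pairDiff_swap a b, neg_mul_neg]
  let F : Fin n → Fin n → ℂ := fun a b =>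
    if a = m then ((z (a, 0) : ℂ) - z (b, 0))⁻¹ * B a b else 0
  have hF : ∀ p ∈ pairsIn (Finset.univ : Finset (Fin n)),
      ∑ α ∈ pairSeqsIn (Finset.univ \ {p.1, p.2}) k, (c2 n (k + 1) : ℂ) * 2 ^ (k + 1) *
        (pairing (pairDiff p x) α * pairing (pairDiff p y) α) *
          ((pairSign p m : ℂ) * ((z (p.1, 0) : ℂ) - z (p.2, 0))⁻¹) =
      -(F p.1 p.2 + F p.2 p.1) := by
    rintro ⟨a, b⟩ hp
    have hab : a ≠ b := by
      simp only [pairsIn, Finset.mem_filter] at hp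
      exact hp.2.ne
    rw [← Finset.sum_mul, ← Finset.mul_sum, sum_pairing_mul_pairing k _ _ _
      ((isSingularOn_univ_of_mem_sing hys).pairDiff (Finset.mem_univ _) (Finset.mem_univ _) hab),
      Finset.card_sdiff_of_subset (Finset.subset_univ _), Finset.card_pair hab, Finset.card_fin,
      ← mul_assoc (_ * _) (pairConst _ _), c2_mul_pairConst hn]
    have hinv : ((z (b, 0) : ℂ) - z (a, 0))⁻¹ = -((z (a, 0) : ℂ) - z (b, 0))⁻¹ := by
      rw [← inv_neg, neg_sub]
    simp only [F, hinv, hB a b, pairSign, eq_comm (a := m)]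
    change -1 * B a b * _ = _
    split_ifs <;> push_cast <;> ring
  have hrhs : ((pd (m, 0) (pdI I (pdI J (Qfun n (k + 1) hk))) z : ℝ) : ℂ) =
      -∑ j ∈ Finset.univ.erase m, ((z (m, 0) : ℂ) - z (j, 0))⁻¹ * B m j := by
    rw [pd_pdI_pdI_Qfun I J m hz', Complex.ofReal_sum]
    trans ∑ α ∈ pairSeqs n (k + 1), (c2 n (k + 1) : ℂ) * 2 ^ (k + 1) *
        (pairing x α * pairing y α) *
          ((pairSign (α 0) m : ℂ) * ((z ((α 0).1, 0) : ℂ) - z ((α 0).2, 0))⁻¹)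
    · refine Finset.sum_congr rfl fun α hα => ?_
      rw [hx, hy, ← hproj I hI α hα, ← hproj J hJ α hα, ← sum_injective_prod_pairSign hI,
        ← sum_injective_prod_pairSign hJ]
      norm_cast
    have hseqs : pairSeqs n (k + 1) = pairSeqsIn Finset.univ (k + 1) := by
      simp [pairSeqsIn]
    rw [hseqs, sum_pairSeqsIn_succ]
    simp only [pairing_cons, Fin.cons_zero]
    rw [Finset.sum_congr rfl hF, Finset.sum_neg_distrib, sum_pairsIn_symm]
    congr 1
    rw [Finset.sum_eq_single m (fun a _ ha => by simp [F, ha]) (by simp)]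
    simp [F]
  refine Eq.trans ?_ hrhs.symm
  rw [gaudinBar, LinearMap.sum_apply, ← shapBilin_apply, map_sum, LinearMap.sum_apply,
    ← Finset.sum_neg_distrib]
  refine Finset.sum_congr rfl fun j hj => ?_
  have hmj : m ≠ j := (Finset.ne_of_mem_erase hj).symm
  rw [LinearMap.smul_apply, map_smul, LinearMap.smul_apply, shapBilin_apply, smul_eq_mul,
    shap_OmegaBar hmj, mul_neg]
  congr 2
  symm
  refine Finset.sum_subset (fun K hK => Finset.mem_powerset.2 (Finset.mem_powersetCard.1 hK).1)
    fun K hK hK' => ?_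
  rw [Finset.mem_powerset] at hK
  have hcard : K.card ≠ k := fun h => hK' (Finset.mem_powersetCard.2 ⟨hK, h⟩)
  have hzero : ∀ a ∈ ({m, j} : Finset (Fin n)), x (insert a K) = 0 := by
    intro a ha
    refine apply_eq_zero_of_mem_weight hxs.1 ?_
    rw [Finset.card_insert_of_notMem fun h => (Finset.mem_sdiff.1 (hK h)).2 ha]
    omega
  simp [pairDiff, hzero m (by simp), hzero j (by simp)]
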